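/- There exists c > 0 such that for all H ∈ ℝ^{m×r} whose entries all satisfy |H_{iℓ}| ≤ c/(2m) and all K ∈ ℝ^{n×r}, one has ‖(X* + H)Kᵀ − M‖₁ ≥ (c/2)‖K‖₁ + ‖M‖₁. -/

import Mathlib

open scoped Matrix

/-- The entrywise `ℓ¹` norm of a real matrix: `‖A‖₁ = Σ_{i,j} |A_{ij}|`. -/
noncomputable def l1norm {m n : ℕ} (A : Matrix (Fin m) (Fin n) ℝ) : ℝ :=
  ∑ i, ∑ j, |A i j|

lemma abs_mulVec_le_sum_abs_mul_abs {m n : ℕ} (A : Matrix (Fin m) (Fin n) ℝ) (v : Fin n → ℝ)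
    (i : Fin m) : |(A *ᵥ v) i| ≤ ∑ l, |A i l| * |v l| := by
  simpa only [Matrix.mulVec, dotProduct, abs_mul] using
    Finset.abs_sum_le_sum_abs (fun l => A i l * v l) Finset.univ

/-- An invertible real matrix is bounded below in the vector `ℓ¹` norm. -/
lemma exists_pos_mul_sum_abs_le_sum_abs_mulVec {r : ℕ} {A : Matrix (Fin r) (Fin r) ℝ}
    (hA : IsUnit A) :
    ∃ c > 0, ∀ v : Fin r → ℝ, c * ∑ l, |v l| ≤ ∑ i, |(A *ᵥ v) i| := by
  set C : ℝ := 1 + l1norm A⁻¹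
  have hCpos : 0 < C := by
    have : 0 ≤ l1norm A⁻¹ := by unfold l1norm; positivity
    linarith
  refine ⟨C⁻¹, inv_pos.mpr hCpos, fun v => ?_⟩
  rw [inv_mul_le_iff₀ hCpos]
  have hv : A⁻¹ *ᵥ (A *ᵥ v) = v := by
    rw [Matrix.mulVec_mulVec, Matrix.nonsing_inv_mul _ ((Matrix.isUnit_iff_isUnit_det A).mp hA),
      Matrix.one_mulVec]
  set w := A *ᵥ v
  have hw : ∀ i, |w i| ≤ ∑ i, |w i| := fun i =>
    Finset.single_le_sum (f := fun i => |w i|) (fun _ _ => abs_nonneg _) (Finset.mem_univ i)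
  have hl : ∀ l, |v l| ≤ (∑ i, |A⁻¹ l i|) * ∑ i, |w i| := by
    intro l
    conv_lhs => rw [← hv]
    rw [Finset.sum_mul]
    refine (abs_mulVec_le_sum_abs_mul_abs _ _ _).trans (Finset.sum_le_sum fun i _ => ?_)
    exact mul_le_mul_of_nonneg_left (hw i) (abs_nonneg _)
  calc ∑ l, |v l| ≤ ∑ l, (∑ i, |A⁻¹ l i|) * ∑ i, |w i| := Finset.sum_le_sum fun l _ => hl l
    _ = l1norm A⁻¹ * ∑ i, |w i| := by rw [← Finset.sum_mul, l1norm]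
    _ ≤ C * ∑ i, |w i| := mul_le_mul_of_nonneg_right (by linarith) (by positivity)

/-- A matrix whose entries are bounded by `b` maps `v` to a vector of `ℓ¹` norm at most
`m * b * ‖v‖₁`. -/
lemma sum_abs_mulVec_le {m r : ℕ} {H : Matrix (Fin m) (Fin r) ℝ} {b : ℝ}
    (hH : ∀ i l, |H i l| ≤ b) (v : Fin r → ℝ) :
    ∑ i, |(H *ᵥ v) i| ≤ m * (b * ∑ l, |v l|) := by
  have hi : ∀ i, |(H *ᵥ v) i| ≤ b * ∑ l, |v l| := by
    intro i
    rw [Finset.mul_sum]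
    refine (abs_mulVec_le_sum_abs_mul_abs _ _ _).trans (Finset.sum_le_sum fun l _ => ?_)
    exact mul_le_mul_of_nonneg_right (hH i l) (abs_nonneg _)
  simpa using Finset.sum_le_sum fun i (_ : i ∈ Finset.univ) => hi i

/-- The entrywise `ℓ¹` norm, summed column by column. -/
lemma l1norm_eq_sum_col {m n : ℕ} (A : Matrix (Fin m) (Fin n) ℝ) :
    l1norm A = ∑ j, ∑ i, |A i j| :=
  Finset.sum_comm

/-- Let `M ∈ ℝ^{m×n}` have its first `r` rows zero, and let `X* ∈ ℝ^{m×r}` have its first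
`r` rows forming an invertible matrix `X̂*` and its remaining rows zero. Then there exists
`c > 0` such that for all `H ∈ ℝ^{m×r}` with all entries of absolute value at most `c/(2m)`
and all `K ∈ ℝ^{n×r}`, one has `‖(X* + H)Kᵀ − M‖₁ ≥ (c/2)‖K‖₁ + ‖M‖₁`. -/
theorem stmt11 (m n r : ℕ) (hm : 0 < m) (hn : 0 < n) (hr : 0 < r) (hrm : r ≤ m)
    (M : Matrix (Fin m) (Fin n) ℝ)
    (hM : ∀ i : Fin m, (i : ℕ) < r → ∀ j, M i j = 0)
    (Xs : Matrix (Fin m) (Fin r) ℝ)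
    (hXsInv : IsUnit (Xs.submatrix (Fin.castLE hrm) id))
    (hXs0 : ∀ i : Fin m, r ≤ (i : ℕ) → ∀ j, Xs i j = 0) :
    ∃ c > 0, ∀ H : Matrix (Fin m) (Fin r) ℝ,
      (∀ i l, |H i l| ≤ c / (2 * m)) →
      ∀ K : Matrix (Fin n) (Fin r) ℝ,
        c / 2 * l1norm K + l1norm M ≤ l1norm ((Xs + H) * Kᵀ - M) := by
  obtain ⟨c, hc, hcv⟩ := exists_pos_mul_sum_abs_le_sum_abs_mulVec hXsInv
  refine ⟨c, hc, fun H hH K => ?_⟩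
  have hm' : (m : ℝ) ≠ 0 := by positivity
  rw [l1norm_eq_sum_col M, l1norm_eq_sum_col (_ - _), l1norm, Finset.mul_sum,
    ← Finset.sum_add_distrib]
  refine Finset.sum_le_sum fun j _ => ?_
  have hsplit : ∀ i, |(Xs *ᵥ K j) i| + |M i j| - |(H *ᵥ K j) i| ≤
      |((Xs + H) * Kᵀ - M) i j| := by
    intro i
    have hentry : ((Xs + H) * Kᵀ - M) i j = ((Xs *ᵥ K j) i - M i j) + (H *ᵥ K j) i := by
      have : ((Xs + H) * Kᵀ) i j = ((Xs + H) *ᵥ K j) i := rfl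
      rw [Matrix.sub_apply, this, Matrix.add_mulVec, Pi.add_apply]
      ring
    have hdisj : |(Xs *ᵥ K j) i - M i j| = |(Xs *ᵥ K j) i| + |M i j| := by
      rcases lt_or_ge (i : ℕ) r with h | h
      · simp [hM i h j]
      · have : (Xs *ᵥ K j) i = 0 := by simp [Matrix.mulVec, dotProduct, hXs0 i h]
        simp [this]
    rw [hentry, ← hdisj]
    have := abs_sub_abs_le_abs_sub ((Xs *ᵥ K j) i - M i j) (-(H *ᵥ K j) i)
    rwa [abs_neg, sub_neg_eq_add] at this
  have hsum := Finset.sum_le_sum fun i (_ : i ∈ Finset.univ) => hsplit i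
  rw [Finset.sum_sub_distrib, Finset.sum_add_distrib] at hsum
  have hX : c * ∑ l, |K j l| ≤ ∑ i, |(Xs *ᵥ K j) i| := by
    refine (hcv (K j)).trans ?_
    have := Finset.sum_le_univ_sum_of_nonneg (f := fun i => |(Xs *ᵥ K j) i|)
      (s := Finset.univ.map (Fin.castLEEmb hrm)) (fun _ => abs_nonneg _)
    rw [Finset.sum_map] at this
    exact this
  have hHK := sum_abs_mulVec_le hH (K j)
  have hhalf : (m : ℝ) * (c / (2 * m) * ∑ l, |K j l|) = c / 2 * ∑ l, |K j l| := by
    field_simp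
  linarith
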